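/- Let (u, v) be drawn uniformly at random from P_n × P_n and let Φ_{n,n} denote the random variable (u, v) ↦ Φ_n(u·v). Then E[Φ_{n,n}] = (n + 1)·q^{2n+1}·(q + 1)/(q^{n+1} − 1)² − (3·q^{n+1} − 1)/((q^{n+1} − 1)·(q − 1)); in particular there is an absolute constant C > 0 with |E[Φ_{n,n}] − (n + 1)| ≤ C·(n + 1)/q, and moreover Var[Φ_{n,n}] ≤ C·n⁴ for every prime power q and every positive integer n. -/

import Mathlib

open Polynomial

/-- `Φ_n(s)`: the number of ordered pairs `(u,v)` of monic polynomials of degree at most `n`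
with `s = u·v`. -/
noncomputable def PhiN {F : Type} [Field F] (n : ℕ) (s : F[X]) : ℕ :=
  Set.ncard {uv : F[X] × F[X] | uv.1.Monic ∧ uv.1.natDegree ≤ n ∧
    uv.2.Monic ∧ uv.2.natDegree ≤ n ∧ s = uv.1 * uv.2}

/-- `E[Φ_{n,n}]`: the expectation of `Φ_n(u·v)` for `(u,v)` uniform on `P_n × P_n`. -/
noncomputable def expPhiNN (F : Type) [Field F] (n : ℕ) : ℝ :=
  (∑ᶠ uv ∈ {uv : F[X] × F[X] | uv.1.Monic ∧ uv.1.natDegree ≤ n ∧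
      uv.2.Monic ∧ uv.2.natDegree ≤ n}, (PhiN n (uv.1 * uv.2) : ℝ)) /
    (Set.ncard {u : F[X] | u.Monic ∧ u.natDegree ≤ n} : ℝ) ^ 2

/-- `Var[Φ_{n,n}]`: the variance of `Φ_n(u·v)` for `(u,v)` uniform on `P_n × P_n`. -/
noncomputable def varPhiNN (F : Type) [Field F] (n : ℕ) : ℝ :=
  (∑ᶠ uv ∈ {uv : F[X] × F[X] | uv.1.Monic ∧ uv.1.natDegree ≤ n ∧
      uv.2.Monic ∧ uv.2.natDegree ≤ n}, (PhiN n (uv.1 * uv.2) : ℝ) ^ 2) /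
    (Set.ncard {u : F[X] | u.Monic ∧ u.natDegree ≤ n} : ℝ) ^ 2 -
    (expPhiNN F n) ^ 2

section Divisibility

variable {F : Type} [Field F]

theorem exists_monic_refinement {a b c d : F[X]} (ha : a.Monic) (hb : b.Monic) (hc : c.Monic)
    (h : a * b = c * d) :
    ∃ g x y k : F[X], g.Monic ∧ x.Monic ∧ y.Monic ∧ k.Monic ∧
      a = g * x ∧ b = y * k ∧ c = g * y ∧ d = x * k := by
  classical
  obtain ⟨g, y, hg, hy, rfl⟩ := exists_dvd_and_dvd_of_dvd_mul (Dvd.intro d h.symm)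
  have hgy : normalize g * normalize y = g * y := by
    rw [← normalize_mul, hc.normalize_eq_self]
  have hg0 : g ≠ 0 := fun h0 => hc.ne_zero (by simp [h0])
  have hy0 : y ≠ 0 := fun h0 => hc.ne_zero (by simp [h0])
  have hgm := monic_normalize hg0
  have hym := monic_normalize hy0
  obtain ⟨x, hx⟩ := normalize_dvd_iff.2 hg
  obtain ⟨k, hk⟩ := normalize_dvd_iff.2 hy
  refine ⟨normalize g, x, normalize y, k, hgm, hgm.of_mul_monic_left (hx ▸ ha), hym,
    hym.of_mul_monic_left (hk ▸ hb), hx, hk, hgy.symm, ?_⟩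
  apply mul_left_cancel₀ hc.ne_zero
  rw [← h, ← hgy, hx, hk]
  ring

theorem exists_monic_gcd {a c : F[X]} (ha : a.Monic) (hc : c.Monic) :
    ∃ g x y : F[X], g.Monic ∧ x.Monic ∧ y.Monic ∧ IsCoprime x y ∧ a = g * x ∧ c = g * y := by
  classical
  have hg0 : EuclideanDomain.gcd a c ≠ 0 := fun h0 =>
    ha.ne_zero (EuclideanDomain.gcd_eq_zero_iff.1 h0).1
  have hgm := monic_normalize hg0
  obtain ⟨x, hx⟩ := normalize_dvd_iff.2 (EuclideanDomain.gcd_dvd_left a c)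
  obtain ⟨y, hy⟩ := normalize_dvd_iff.2 (EuclideanDomain.gcd_dvd_right a c)
  refine ⟨_, x, y, hgm, hgm.of_mul_monic_left (hx ▸ ha), hgm.of_mul_monic_left (hy ▸ hc),
    ?_, hx, hy⟩
  have hbez := EuclideanDomain.gcd_eq_gcd_ab a c
  have hnorm := normalize_apply (EuclideanDomain.gcd a c)
  generalize EuclideanDomain.gcdA a c = s at *
  generalize EuclideanDomain.gcdB a c = t at *
  generalize (↑(normUnit (EuclideanDomain.gcd a c)) : F[X]) = w at *
  generalize normalize (EuclideanDomain.gcd a c) = g at *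
  refine ⟨s * w, t * w, mul_left_cancel₀ hgm.ne_zero ?_⟩
  calc g * (s * w * x + t * w * y) = ((g * x) * s + (g * y) * t) * w := by ring
    _ = g * 1 := by rw [← hx, ← hy, ← hbez, ← hnorm, mul_one]

theorem mul_coprime_pair_injective {g x y g' x' y' : F[X]} (hg : g.Monic) (hg' : g'.Monic)
    (h : IsCoprime x y) (h' : IsCoprime x' y') (hx : g * x = g' * x') (hy : g * y = g' * y') :
    g = g' ∧ x = x' ∧ y = y' := by
  have key : ∀ {g x y g' x' y' : F[X]}, IsCoprime x y → g * x = g' * x' → g * y = g' * y' →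
      g' ∣ g := by
    rintro g x y g' x' y' ⟨s, t, hst⟩ hx hy
    refine ⟨s * x' + t * y', ?_⟩
    linear_combination (-g) * hst + s * hx + t * hy
  obtain rfl : g = g' := eq_of_monic_of_associated hg hg'
    (associated_of_dvd_dvd (key h' hx.symm hy.symm) (key h hx hy))
  exact ⟨rfl, mul_left_cancel₀ hg.ne_zero hx, mul_left_cancel₀ hg.ne_zero hy⟩

theorem natDegree_mul_pair_le_iff {g x y : F[X]} (hg : g.Monic) (hx : x.Monic) (hy : y.Monic)
    (n : ℕ) :
    ((g * x).natDegree ≤ n ∧ (g * y).natDegree ≤ n) ↔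
      max x.natDegree y.natDegree ≤ n ∧ g.natDegree ≤ n - max x.natDegree y.natDegree := by
  rw [hg.natDegree_mul hx, hg.natDegree_mul hy]
  omega

end Divisibility

section Counting

open Finset

variable (F : Type) [Field F] [Fintype F]

theorem finite_monic_natDegree_eq (n : ℕ) : {u : F[X] | u.Monic ∧ u.natDegree = n}.Finite :=
  Set.finite_coe_iff.1 (Finite.of_equiv _
    ((monicEquivDegreeLT n).trans (degreeLTEquiv F n).toEquiv).symm)

/-- The monic polynomials of degree `n`. -/
noncomputable def monicOfDegree (n : ℕ) : Finset F[X] := (finite_monic_natDegree_eq F n).toFinset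

variable {F} in
@[simp]
theorem mem_monicOfDegree {n : ℕ} {u : F[X]} :
    u ∈ monicOfDegree F n ↔ u.Monic ∧ u.natDegree = n := by
  simp [monicOfDegree]

theorem card_monicOfDegree (n : ℕ) : #(monicOfDegree F n) = Fintype.card F ^ n := by
  have e : {u // u ∈ monicOfDegree F n} ≃ (Fin n → F) :=
    (Equiv.subtypeEquivRight fun _ => mem_monicOfDegree).trans
      ((monicEquivDegreeLT n).trans (degreeLTEquiv F n).toEquiv)
  rw [← Fintype.card_coe, Fintype.card_congr e]
  simp

/-- The monic polynomials of degree at most `n`. -/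
noncomputable def monicOfDegreeLE (n : ℕ) : Finset F[X] := by
  classical exact (range (n + 1)).biUnion (monicOfDegree F)

variable {F} in
@[simp]
theorem mem_monicOfDegreeLE {n : ℕ} {u : F[X]} :
    u ∈ monicOfDegreeLE F n ↔ u.Monic ∧ u.natDegree ≤ n := by
  simp [monicOfDegreeLE, and_comm]

theorem card_monicOfDegreeLE (n : ℕ) :
    #(monicOfDegreeLE F n) = ∑ i ∈ range (n + 1), Fintype.card F ^ i := by
  classical
  rw [monicOfDegreeLE, card_biUnion]
  · simp only [card_monicOfDegree]
  · intro i _ j _ hij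
    refine Finset.disjoint_left.2 fun u hu hu' => hij ?_
    rw [mem_monicOfDegree] at hu hu'
    exact hu.2.symm.trans hu'.2

theorem ncard_monic_natDegree_le (n : ℕ) :
    Set.ncard {u : F[X] | u.Monic ∧ u.natDegree ≤ n} = #(monicOfDegreeLE F n) := by
  rw [← Set.ncard_coe_finset]
  congr 1
  ext u
  simp

/-- The factorizations of `s` as a product of two monic polynomials of degree at most `n`. -/
noncomputable def factorizations (n : ℕ) (s : F[X]) : Finset (F[X] × F[X]) := by
  classical exact {p ∈ monicOfDegreeLE F n ×ˢ monicOfDegreeLE F n | s = p.1 * p.2}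

variable {F} in
theorem mem_factorizations {n : ℕ} {s : F[X]} {p : F[X] × F[X]} :
    p ∈ factorizations F n s ↔ (p.1 ∈ monicOfDegreeLE F n ∧ p.2 ∈ monicOfDegreeLE F n) ∧
      s = p.1 * p.2 := by
  simp [factorizations]

variable {F} in
theorem PhiN_eq_card (n : ℕ) (s : F[X]) : PhiN n s = #(factorizations F n s) := by
  rw [PhiN, ← Set.ncard_coe_finset]
  congr 1
  ext u
  simp [mem_factorizations, and_assoc]

theorem finsum_pairs_eq_sum (n : ℕ) (f : F[X] × F[X] → ℝ) :
    ∑ᶠ uv ∈ {uv : F[X] × F[X] | uv.1.Monic ∧ uv.1.natDegree ≤ n ∧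
      uv.2.Monic ∧ uv.2.natDegree ≤ n}, f uv =
    ∑ uv ∈ monicOfDegreeLE F n ×ˢ monicOfDegreeLE F n, f uv := by
  rw [← finsum_mem_coe_finset]
  congr! 3 with uv
  simp [and_assoc]

/-- The coprime pairs of monic polynomials whose larger degree is `m`. -/
noncomputable def coprimePairs (m : ℕ) : Finset (F[X] × F[X]) := by
  classical exact {p ∈ monicOfDegreeLE F m ×ˢ monicOfDegreeLE F m |
    IsCoprime p.1 p.2 ∧ max p.1.natDegree p.2.natDegree = m}

variable {F} in
theorem mem_coprimePairs {m : ℕ} {p : F[X] × F[X]} :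
    p ∈ coprimePairs F m ↔ p.1.Monic ∧ p.2.Monic ∧ IsCoprime p.1 p.2 ∧
      max p.1.natDegree p.2.natDegree = m := by
  simp only [coprimePairs, mem_filter, mem_product, mem_monicOfDegreeLE]
  constructor
  · rintro ⟨⟨⟨h1, -⟩, h2, -⟩, h⟩
    exact ⟨h1, h2, h⟩
  · rintro ⟨h1, h2, h3, rfl⟩
    exact ⟨⟨⟨h1, le_max_left _ _⟩, h2, le_max_right _ _⟩, h3, rfl⟩

theorem sum_card_coprimePairs_mul (n : ℕ) :
    ∑ m ∈ range (n + 1), #(coprimePairs F m) * #(monicOfDegreeLE F (n - m)) =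
      #(monicOfDegreeLE F n) ^ 2 := by
  simp only [← card_product, ← card_sigma, sq]
  refine card_nbij (fun z => (z.2.2 * z.2.1.1, z.2.2 * z.2.1.2)) ?_ ?_ ?_
  · rintro ⟨m, ⟨x, y⟩, g⟩ h
    simp only [coe_sigma, Set.mem_sigma_iff, mem_coe, mem_range, mem_product, mem_coprimePairs,
      mem_monicOfDegreeLE] at h ⊢
    obtain ⟨hm, ⟨hx, hy, -, rfl⟩, hg, hgd⟩ := h
    have := (natDegree_mul_pair_le_iff hg hx hy n).2 ⟨by omega, hgd⟩
    exact ⟨⟨hg.mul hx, this.1⟩, hg.mul hy, this.2⟩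
  · rintro ⟨m, ⟨x, y⟩, g⟩ h ⟨m', ⟨x', y'⟩, g'⟩ h' heq
    simp only [coe_sigma, Set.mem_sigma_iff, mem_coe, mem_product, mem_coprimePairs,
      mem_monicOfDegreeLE, Prod.mk.injEq] at h h' heq
    obtain ⟨-, ⟨-, -, hc, rfl⟩, hg, -⟩ := h
    obtain ⟨-, ⟨-, -, hc', rfl⟩, hg', -⟩ := h'
    obtain ⟨rfl, rfl, rfl⟩ := mul_coprime_pair_injective hg hg' hc hc' heq.1 heq.2
    rfl
  · rintro ⟨a, c⟩ h
    simp only [mem_coe, mem_product, mem_monicOfDegreeLE] at h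
    obtain ⟨⟨ha, had⟩, hc, hcd⟩ := h
    obtain ⟨g, x, y, hg, hx, hy, hco, rfl, rfl⟩ := exists_monic_gcd ha hc
    have := (natDegree_mul_pair_le_iff hg hx hy n).1 ⟨had, hcd⟩
    refine ⟨⟨max x.natDegree y.natDegree, (x, y), g⟩, ?_, rfl⟩
    simp only [coe_sigma, Set.mem_sigma_iff, mem_coe, mem_range, mem_product, mem_coprimePairs,
      mem_monicOfDegreeLE]
    exact ⟨by omega, ⟨hx, hy, hco, trivial⟩, hg, this.2⟩

theorem sum_card_factorizations (n : ℕ) :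
    ∑ p ∈ monicOfDegreeLE F n ×ˢ monicOfDegreeLE F n, #(factorizations F n (p.1 * p.2)) =
      ∑ m ∈ range (n + 1), #(coprimePairs F m) * #(monicOfDegreeLE F (n - m)) ^ 2 := by
  simp only [← card_product, ← card_sigma, sq]
  symm
  refine card_nbij (fun z => ⟨(z.2.2.1 * z.2.1.1, z.2.2.2 * z.2.1.2),
    (z.2.2.1 * z.2.1.2, z.2.2.2 * z.2.1.1)⟩) ?_ ?_ ?_
  · rintro ⟨m, ⟨x, y⟩, g, k⟩ h
    simp only [coe_sigma, Set.mem_sigma_iff, mem_coe, mem_range, mem_product, mem_coprimePairs,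
      mem_monicOfDegreeLE, mem_factorizations] at h ⊢
    obtain ⟨hm, ⟨hx, hy, -, rfl⟩, ⟨hg, hgd⟩, hk, hkd⟩ := h
    have hgxy := (natDegree_mul_pair_le_iff hg hx hy n).2 ⟨by omega, hgd⟩
    have hkxy := (natDegree_mul_pair_le_iff hk hx hy n).2 ⟨by omega, hkd⟩
    exact ⟨⟨⟨hg.mul hx, hgxy.1⟩, hk.mul hy, hkxy.2⟩, ⟨⟨hg.mul hy, hgxy.2⟩, hk.mul hx, hkxy.1⟩,
      by ring⟩
  · rintro ⟨m, ⟨x, y⟩, g, k⟩ h ⟨m', ⟨x', y'⟩, g', k'⟩ h' heq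
    simp only [coe_sigma, Set.mem_sigma_iff, mem_coe, mem_product, mem_coprimePairs,
      mem_monicOfDegreeLE, Sigma.mk.injEq, heq_eq_eq, Prod.mk.injEq] at h h' heq
    obtain ⟨-, ⟨hx, -, hc, rfl⟩, ⟨hg, -⟩, hk, -⟩ := h
    obtain ⟨-, ⟨-, -, hc', rfl⟩, ⟨hg', -⟩, hk', -⟩ := h'
    obtain ⟨⟨h1, h2⟩, h3, h4⟩ := heq
    obtain ⟨rfl, rfl, rfl⟩ := mul_coprime_pair_injective hg hg' hc hc' h1 h3
    obtain rfl := mul_right_cancel₀ hx.ne_zero h4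
    rfl
  · rintro ⟨⟨a, b⟩, c, d⟩ h
    simp only [coe_sigma, Set.mem_sigma_iff, mem_coe, mem_product, mem_monicOfDegreeLE,
      mem_factorizations] at h
    obtain ⟨⟨⟨ha, had⟩, hb, hbd⟩, ⟨⟨hc, hcd⟩, hd, hdd⟩, heq⟩ := h
    obtain ⟨g, x, y, hg, hx, hy, hco, rfl, rfl⟩ := exists_monic_gcd ha hc
    have hxy : x * b = y * d := mul_left_cancel₀ hg.ne_zero (by linear_combination heq)
    obtain ⟨k, rfl⟩ := hco.symm.dvd_of_dvd_mul_left (Dvd.intro d hxy.symm)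
    have hk := hy.of_mul_monic_left hb
    obtain rfl : d = x * k := mul_left_cancel₀ hy.ne_zero (by linear_combination -hxy)
    rw [mul_comm] at hbd hdd
    have hgd := (natDegree_mul_pair_le_iff hg hx hy n).1 ⟨had, hcd⟩
    have hkd := (natDegree_mul_pair_le_iff hk hx hy n).1 ⟨hdd, hbd⟩
    refine ⟨⟨max x.natDegree y.natDegree, (x, y), (g, k)⟩, ?_, ?_⟩
    · simp only [coe_sigma, Set.mem_sigma_iff, mem_coe, mem_range, mem_product, mem_coprimePairs,
        mem_monicOfDegreeLE]
      exact ⟨by omega, ⟨hx, hy, hco, trivial⟩, ⟨hg, hgd.2⟩, hk, hkd.2⟩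
    · simp only [mul_comm]

end Counting

section Moments

open Finset

theorem sum_range_sub_succ (q : ℝ) (f : ℕ → ℝ) (n : ℕ) :
    ∑ m ∈ range (n + 1), (q + 1) * q ^ (2 * m + 1) * f (n - m) =
      q * (q + 1) * f n +
        q ^ 2 * ∑ m ∈ range n, (q + 1) * q ^ (2 * m + 1) * f (n - (m + 1)) := by
  rw [sum_range_succ', mul_sum, add_comm]
  congr 1
  · rw [Nat.sub_zero]
    ring
  · exact sum_congr rfl fun m _ => by ring

theorem sum_mul_geom_eq {q : ℝ} {A : ℕ → ℝ} (hA0 : A 0 = 1) (hA : ∀ n, A (n + 1) = q * A n + 1)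
    (n : ℕ) :
    ∑ m ∈ range n, (q + 1) * q ^ (2 * m + 1) * A (n - (m + 1)) = A n ^ 2 - A n := by
  induction n with
  | zero => simp [hA0]
  | succ n ih =>
    simp only [Nat.add_sub_add_right]
    rw [sum_range_sub_succ, ih, hA]
    ring

theorem eq_of_convolution_geom {q : ℝ} {A c : ℕ → ℝ} (hA0 : A 0 = 1)
    (hA : ∀ n, A (n + 1) = q * A n + 1)
    (hc : ∀ n, ∑ m ∈ range (n + 1), c m * A (n - m) = A n ^ 2) :
    c 0 = 1 ∧ ∀ m, c (m + 1) = (q + 1) * q ^ (2 * m + 1) := by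
  have h0 : c 0 = 1 := by simpa [hA0] using hc 0
  refine ⟨h0, fun m => ?_⟩
  induction m using Nat.strong_induction_on with
  | _ m ih =>
    have h1 := hc (m + 1)
    have h2 := sum_mul_geom_eq hA0 hA (m + 1)
    rw [sum_range_succ', sum_range_succ, h0, sum_congr rfl fun i hi => by
      rw [ih i (mem_range.1 hi)]] at h1
    rw [sum_range_succ] at h2
    simp only [Nat.sub_self, Nat.sub_zero, hA0] at h1 h2
    linarith

theorem sum_mul_geom_sq_closed_form {q : ℝ} {A : ℕ → ℝ}
    (hA : ∀ n, A n * (q - 1) = q ^ (n + 1) - 1) (n : ℕ) :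
    (∑ m ∈ range n, (q + 1) * q ^ (2 * m + 1) * A (n - (m + 1)) ^ 2) * (q - 1) ^ 3 =
      (n + 1) * q ^ (2 * n + 1) * (q ^ 2 - 1) - (3 * q ^ (n + 1) - 1) * (q ^ (n + 1) - 1) -
        (q ^ (n + 1) - 1) ^ 2 * (q - 1) := by
  induction n with
  | zero => simp; ring
  | succ n ih =>
    simp only [Nat.add_sub_add_right]
    rw [sum_range_sub_succ q (fun k => A k ^ 2)]
    push_cast
    linear_combination q ^ 2 * ih +
      q * (q + 1) * (q - 1) * (A n * (q - 1) + (q ^ (n + 1) - 1)) * hA n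

theorem sum_mul_geom_sq_le {q : ℝ} {A : ℕ → ℝ} (hq : 0 < q) (hpos : ∀ n, 0 ≤ A n)
    (hA : ∀ n, A (n + 1) = q * A n + 1) (n : ℕ) :
    ∑ m ∈ range n, (q + 1) * q ^ (2 * m + 1) * A (n - (m + 1)) ^ 2 ≤
      n * (1 + 1 / q) * A n ^ 2 := by
  induction n with
  | zero => simp
  | succ n ih =>
    simp only [Nat.add_sub_add_right]
    rw [sum_range_sub_succ q (fun k => A k ^ 2)]
    have h1 : (q * A n) ^ 2 ≤ A (n + 1) ^ 2 := by
      have := hpos n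
      rw [hA]
      gcongr
      linarith
    calc _ ≤ q * (q + 1) * A n ^ 2 + q ^ 2 * (n * (1 + 1 / q) * A n ^ 2) := by gcongr
      _ = (n + 1) * (1 + 1 / q) * (q * A n) ^ 2 := by field_simp; ring
      _ ≤ _ := by push_cast; gcongr

theorem le_sum_mul_geom_sq {q : ℝ} {A : ℕ → ℝ} (hq : 0 < q) (hpow : ∀ n, q ^ n ≤ A n) (n : ℕ) :
    n * (1 + 1 / q) * q ^ (2 * n) ≤
      ∑ m ∈ range n, (q + 1) * q ^ (2 * m + 1) * A (n - (m + 1)) ^ 2 := by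
  induction n with
  | zero => simp
  | succ n ih =>
    simp only [Nat.add_sub_add_right]
    rw [sum_range_sub_succ q (fun k => A k ^ 2)]
    calc _ = q * (q + 1) * (q ^ n) ^ 2 + q ^ 2 * (n * (1 + 1 / q) * q ^ (2 * n)) := by
          push_cast; field_simp; ring
      _ ≤ _ := by have := hpow n; gcongr

end Moments

section Expectation

open Finset

variable (F : Type) [Field F] [Fintype F]

theorem card_monicOfDegreeLE_zero : (#(monicOfDegreeLE F 0) : ℝ) = 1 := by
  simp [card_monicOfDegreeLE]

theorem card_monicOfDegreeLE_succ (n : ℕ) :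
    (#(monicOfDegreeLE F (n + 1)) : ℝ) = Fintype.card F * #(monicOfDegreeLE F n) + 1 := by
  rw [card_monicOfDegreeLE, card_monicOfDegreeLE, geom_sum_succ]
  push_cast
  rfl

theorem card_monicOfDegreeLE_mul (n : ℕ) :
    (#(monicOfDegreeLE F n) : ℝ) * (Fintype.card F - 1) = (Fintype.card F : ℝ) ^ (n + 1) - 1 := by
  rw [card_monicOfDegreeLE]
  push_cast
  exact geom_sum_mul _ _

theorem pow_card_le_card_monicOfDegreeLE (n : ℕ) :
    (Fintype.card F : ℝ) ^ n ≤ #(monicOfDegreeLE F n) := by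
  rw [card_monicOfDegreeLE]
  push_cast
  exact single_le_sum (f := fun i => (Fintype.card F : ℝ) ^ i) (fun i _ => by positivity)
    (self_mem_range_succ n)

theorem two_le_card_real : (2 : ℝ) ≤ Fintype.card F := by
  exact_mod_cast Fintype.one_lt_card (α := F)

theorem expPhiNN_eq_sum (n : ℕ) :
    expPhiNN F n = (#(monicOfDegreeLE F n) ^ 2 + ∑ m ∈ range n, ((Fintype.card F : ℝ) + 1) *
      (Fintype.card F : ℝ) ^ (2 * m + 1) * (#(monicOfDegreeLE F (n - (m + 1))) : ℝ) ^ 2) /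
        (#(monicOfDegreeLE F n) : ℝ) ^ 2 := by
  obtain ⟨h0, hs⟩ := eq_of_convolution_geom (A := fun m => (#(monicOfDegreeLE F m) : ℝ))
    (c := fun m => (#(coprimePairs F m) : ℝ))
    (card_monicOfDegreeLE_zero F) (card_monicOfDegreeLE_succ F)
    (fun n => by exact_mod_cast sum_card_coprimePairs_mul F n)
  rw [expPhiNN, finsum_pairs_eq_sum, ncard_monic_natDegree_le]
  simp only [PhiN_eq_card]
  rw [← Nat.cast_sum, sum_card_factorizations]
  push_cast
  rw [sum_range_succ']
  simp only [h0, hs]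
  simp [add_comm]

theorem expPhiNN_closed_form (n : ℕ) :
    expPhiNN F n =
      ((n : ℝ) + 1) * (Fintype.card F : ℝ) ^ (2 * n + 1) *
          ((Fintype.card F : ℝ) + 1) / ((Fintype.card F : ℝ) ^ (n + 1) - 1) ^ 2 -
        (3 * (Fintype.card F : ℝ) ^ (n + 1) - 1) /
          (((Fintype.card F : ℝ) ^ (n + 1) - 1) * ((Fintype.card F : ℝ) - 1)) := by
  have hq := two_le_card_real F
  have hclosed := sum_mul_geom_sq_closed_form (card_monicOfDegreeLE_mul F) n
  have hA := card_monicOfDegreeLE_mul F n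
  have hApos := (pow_pos (by linarith : (0 : ℝ) < Fintype.card F) n).trans_le (
    pow_card_le_card_monicOfDegreeLE F n)
  rw [expPhiNN_eq_sum]
  generalize (∑ m ∈ range n, ((Fintype.card F : ℝ) + 1) *
      (Fintype.card F : ℝ) ^ (2 * m + 1) * (#(monicOfDegreeLE F (n - (m + 1))) : ℝ) ^ 2) = T at *
  generalize (#(monicOfDegreeLE F n) : ℝ) = A at *
  generalize (Fintype.card F : ℝ) = q at *
  have hq1 : q - 1 ≠ 0 := by linarith
  have hQ : q ^ (n + 1) - 1 ≠ 0 := by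
    rw [← hA]
    positivity
  obtain rfl : A = (q ^ (n + 1) - 1) / (q - 1) := eq_div_of_mul_eq hq1 hA
  obtain rfl := eq_div_of_mul_eq (pow_ne_zero 3 hq1) hclosed
  generalize q ^ (n + 1) = Q at *
  field_simp
  ring

theorem abs_expPhiNN_sub_le (n : ℕ) :
    |expPhiNN F n - ((n : ℝ) + 1)| ≤ 2 * ((n : ℝ) + 1) / (Fintype.card F : ℝ) := by
  have hq := two_le_card_real F
  have hA := card_monicOfDegreeLE_mul F n
  have hApos := (pow_pos (by linarith : (0 : ℝ) < Fintype.card F) n).trans_le (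
    pow_card_le_card_monicOfDegreeLE F n)
  have hle := sum_mul_geom_sq_le (A := fun m => (#(monicOfDegreeLE F m) : ℝ))
    (by linarith : (0 : ℝ) < Fintype.card F) (fun n => Nat.cast_nonneg _)
    (card_monicOfDegreeLE_succ F) n
  have hge := le_sum_mul_geom_sq (by linarith : (0 : ℝ) < Fintype.card F)
    (pow_card_le_card_monicOfDegreeLE F) n
  rw [expPhiNN_eq_sum]
  generalize (∑ m ∈ range n, ((Fintype.card F : ℝ) + 1) *
      (Fintype.card F : ℝ) ^ (2 * m + 1) * (#(monicOfDegreeLE F (n - (m + 1))) : ℝ) ^ 2) = T at *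
  generalize (#(monicOfDegreeLE F n) : ℝ) = A at *
  generalize (Fintype.card F : ℝ) = q at *
  have hq0 : 0 < q := by linarith
  have hn : (0 : ℝ) ≤ n := Nat.cast_nonneg n
  have hpow : A * (1 - 1 / q) ≤ q ^ n := by
    rw [← mul_le_mul_iff_left₀ hq0]
    calc A * (1 - 1 / q) * q = A * (q - 1) := by field_simp
      _ ≤ q ^ n * q := by rw [hA, pow_succ]; linarith
  have hinv : 1 / q ≤ 1 / 2 := one_div_le_one_div_of_le two_pos hq
  have hinv0 : 0 < 1 / q := by positivity
  have hsq : (1 - 2 / q) * A ^ 2 ≤ q ^ (2 * n) := by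
    calc (1 - 2 / q) * A ^ 2 ≤ (A * (1 - 1 / q)) ^ 2 := by
          have : (A * (1 - 1 / q)) ^ 2 = (1 - 2 / q) * A ^ 2 + (A * (1 / q)) ^ 2 := by ring
          rw [this]
          nlinarith [sq_nonneg (A * (1 / q))]
      _ ≤ (q ^ n) ^ 2 := by
          have : 0 ≤ 1 - 1 / q := by linarith
          gcongr
      _ = q ^ (2 * n) := by ring
  have hlow : n * (1 - 2 / q) * A ^ 2 ≤ T := by
    refine le_trans ?_ hge
    calc n * (1 - 2 / q) * A ^ 2 = n * ((1 - 2 / q) * A ^ 2) := by ring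
      _ ≤ n * q ^ (2 * n) := by gcongr
      _ ≤ n * (1 + 1 / q) * q ^ (2 * n) := by
        gcongr
        nlinarith
  have hlow' : n * (1 - 2 / q) ≤ T / A ^ 2 := by rwa [le_div_iff₀ (by positivity)]
  have hup' : T / A ^ 2 ≤ n * (1 + 1 / q) := by rwa [div_le_iff₀ (by positivity)]
  have hsplit : (A ^ 2 + T) / A ^ 2 = 1 + T / A ^ 2 := by field_simp
  have h1 : n * (2 / q) = 2 * (n * (1 / q)) := by ring
  have h2 : 2 * ((n : ℝ) + 1) / q = 2 * (n * (1 / q)) + 2 * (1 / q) := by ring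
  have h3 : 0 ≤ n * (1 / q) := by positivity
  rw [hsplit, h2, abs_le]
  constructor <;> nlinarith

end Expectation

section SecondMoment

open Finset

/-- The degrees of the eight pieces of a simultaneous refinement of three factorizations, into two
factors of degree at most `n`, of one polynomial. The binary digits of the index of a piece tell
which factor of each factorization it divides. -/
def refinementDegrees (n : ℕ) : Finset (Fin 8 → ℕ) :=
  {d ∈ Fintype.piFinset fun _ => range (n + 1) |
    (d 0 + d 1 + d 2 + d 3 ≤ n ∧ d 4 + d 5 + d 6 + d 7 ≤ n) ∧
    (d 0 + d 1 + d 4 + d 5 ≤ n ∧ d 2 + d 3 + d 6 + d 7 ≤ n) ∧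
    (d 0 + d 2 + d 4 + d 6 ≤ n ∧ d 1 + d 3 + d 5 + d 7 ≤ n)}

theorem mem_refinementDegrees {n : ℕ} {d : Fin 8 → ℕ} :
    d ∈ refinementDegrees n ↔
      (d 0 + d 1 + d 2 + d 3 ≤ n ∧ d 4 + d 5 + d 6 + d 7 ≤ n) ∧
      (d 0 + d 1 + d 4 + d 5 ≤ n ∧ d 2 + d 3 + d 6 + d 7 ≤ n) ∧
      (d 0 + d 2 + d 4 + d 6 ≤ n ∧ d 1 + d 3 + d 5 + d 7 ≤ n) := by
  simp only [refinementDegrees, mem_filter, Fintype.mem_piFinset, mem_range, and_iff_right_iff_imp]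
  intro h i
  fin_cases i <;> simp <;> omega

theorem card_refinementDegrees_sum_eq_le (n j : ℕ) :
    #{d ∈ refinementDegrees n | 2 * n - ∑ i, d i = j} ≤ (n + 1) ^ 4 * (j + 1) ^ 3 := by
  let f : (Fin 8 → ℕ) → (ℕ × ℕ × ℕ × ℕ) × (ℕ × ℕ × ℕ) := fun d =>
    ((d 3, d 5, d 6, d 7), (n - (d 4 + d 5 + d 6 + d 7), n - (d 2 + d 3 + d 6 + d 7),
      n - (d 1 + d 3 + d 5 + d 7)))
  have hcard := card_le_card_of_injOn
    (s := {d ∈ refinementDegrees n | 2 * n - ∑ i, d i = j})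
    (t := (range (n + 1) ×ˢ range (n + 1) ×ˢ range (n + 1) ×ˢ range (n + 1)) ×ˢ
      (range (j + 1) ×ˢ range (j + 1) ×ˢ range (j + 1))) f ?_ ?_
  · refine hcard.trans_eq ?_
    simp only [card_product, card_range]
    ring
  · intro d hd
    simp only [coe_filter, Set.mem_ofPred_eq, mem_refinementDegrees, Fin.sum_univ_eight] at hd
    simp only [f, coe_product, Set.mem_prod, mem_coe, mem_range]
    omega
  · intro d hd e he hde
    simp only [coe_filter, Set.mem_ofPred_eq, mem_refinementDegrees, Fin.sum_univ_eight] at hd he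
    simp only [f, Prod.mk.injEq] at hde
    funext i
    fin_cases i <;> simp <;> omega

theorem sum_succ_cube_div_two_pow (k : ℕ) :
    ∑ j ∈ range k, ((j : ℝ) + 1) ^ 3 / 2 ^ j =
      52 - (2 * (k : ℝ) ^ 3 + 12 * (k : ℝ) ^ 2 + 36 * k + 52) / 2 ^ k := by
  induction k with
  | zero => simp
  | succ k ih =>
    rw [sum_range_succ, ih]
    push_cast
    field_simp
    ring

theorem sum_pow_refinementDegrees_le {q : ℝ} (hq : 2 ≤ q) (n : ℕ) :
    ∑ d ∈ refinementDegrees n, q ^ (∑ i, d i) ≤ 52 * ((n : ℝ) + 1) ^ 4 * q ^ (2 * n) := by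
  have hq0 : 0 < q := by linarith
  have hsum : ∀ d ∈ refinementDegrees n, ∑ i, d i ≤ 2 * n := fun d hd => by
    rw [mem_refinementDegrees] at hd
    rw [Fin.sum_univ_eight]
    omega
  rw [← sum_fiberwise_of_maps_to (t := range (2 * n + 1)) (g := fun d => 2 * n - ∑ i, d i)
    fun d _ => mem_range.2 (Nat.lt_succ_of_le (Nat.sub_le _ _))]
  calc _ ≤ ∑ j ∈ range (2 * n + 1),
        ((n : ℝ) + 1) ^ 4 * q ^ (2 * n) * (((j : ℝ) + 1) ^ 3 / 2 ^ j) := by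
        refine sum_le_sum fun j hj => ?_
        have hterm : ∀ d ∈ ({d ∈ refinementDegrees n | 2 * n - ∑ i, d i = j} : Finset _),
            q ^ (∑ i, d i) ≤ q ^ (2 * n) / 2 ^ j := fun d hd => by
          rw [mem_filter] at hd
          have := hsum d hd.1
          rw [le_div_iff₀ (by positivity), show 2 * n = ∑ i, d i + j by omega, pow_add]
          gcongr
        refine (sum_le_card_nsmul _ _ _ hterm).trans ?_
        have hc : (#{d ∈ refinementDegrees n | 2 * n - ∑ i, d i = j} : ℝ) ≤
            ((n : ℝ) + 1) ^ 4 * ((j : ℝ) + 1) ^ 3 := by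
          exact_mod_cast card_refinementDegrees_sum_eq_le n j
        rw [nsmul_eq_mul]
        calc _ ≤ ((n : ℝ) + 1) ^ 4 * ((j : ℝ) + 1) ^ 3 * (q ^ (2 * n) / 2 ^ j) := by gcongr
          _ = _ := by ring
    _ ≤ ((n : ℝ) + 1) ^ 4 * q ^ (2 * n) * 52 := by
        rw [← mul_sum, sum_succ_cube_div_two_pow]
        gcongr
        exact sub_le_self _ (by positivity)
    _ = _ := by ring

theorem exists_monic_refinement_three {F : Type} [Field F] {u₁ v₁ u₂ v₂ u₃ v₃ : F[X]}
    (hu₁ : u₁.Monic) (hv₁ : v₁.Monic) (hu₂ : u₂.Monic) (hu₃ : u₃.Monic)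
    (h₂ : u₁ * v₁ = u₂ * v₂) (h₃ : u₁ * v₁ = u₃ * v₃) :
    ∃ g : Fin 8 → F[X], (∀ i, (g i).Monic) ∧
      (u₁ = g 0 * g 1 * g 2 * g 3 ∧ v₁ = g 4 * g 5 * g 6 * g 7) ∧
      (u₂ = g 0 * g 1 * g 4 * g 5 ∧ v₂ = g 2 * g 3 * g 6 * g 7) ∧
      (u₃ = g 0 * g 2 * g 4 * g 6 ∧ v₃ = g 1 * g 3 * g 5 * g 7) := by
  obtain ⟨g, x, y, k, hg, hx, hy, hk, rfl, rfl, rfl, rfl⟩ := exists_monic_refinement hu₁ hv₁ hu₂ h₂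
  obtain ⟨g', x', y', k', hg', hx', hy', hk', hu, hv, rfl, rfl⟩ :=
    exists_monic_refinement hu₁ hv₁ hu₃ h₃
  obtain ⟨p₀, p₁, p₂, p₃, hp₀, hp₁, hp₂, hp₃, rfl, rfl, rfl, rfl⟩ :=
    exists_monic_refinement hg hx hg' hu
  obtain ⟨p₄, p₅, p₆, p₇, hp₄, hp₅, hp₆, hp₇, rfl, rfl, rfl, rfl⟩ :=
    exists_monic_refinement hy hk hy' hv
  refine ⟨![p₀, p₁, p₂, p₃, p₄, p₅, p₆, p₇], ?_, ⟨?_, ?_⟩, ⟨?_, ?_⟩, ?_, ?_⟩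
  · intro i
    fin_cases i <;> assumption
  all_goals
    simp
    ring

variable (F : Type) [Field F] [Fintype F]

theorem sum_card_factorizations_sq_le (n : ℕ) :
    ∑ p ∈ monicOfDegreeLE F n ×ˢ monicOfDegreeLE F n, #(factorizations F n (p.1 * p.2)) ^ 2 ≤
      ∑ d ∈ refinementDegrees n, Fintype.card F ^ (∑ i, d i) := by
  classical
  simp only [sq, ← card_product, ← card_sigma]
  let f : (Fin 8 → F[X]) → (_ : F[X] × F[X]) × (F[X] × F[X]) × (F[X] × F[X]) := fun g =>
    ⟨(g 0 * g 1 * g 2 * g 3, g 4 * g 5 * g 6 * g 7), (g 0 * g 1 * g 4 * g 5,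
      g 2 * g 3 * g 6 * g 7), (g 0 * g 2 * g 4 * g 6, g 1 * g 3 * g 5 * g 7)⟩
  calc _ ≤ #((refinementDegrees n).biUnion fun d =>
        Fintype.piFinset fun i => monicOfDegree F (d i)) := by
        refine card_le_card_of_surjOn f ?_
        rintro ⟨⟨u₁, v₁⟩, ⟨u₂, v₂⟩, u₃, v₃⟩ h
        simp only [coe_sigma, Set.mem_sigma_iff, mem_coe, mem_product, mem_monicOfDegreeLE,
          mem_factorizations] at h
        obtain ⟨⟨⟨hu₁, hu₁d⟩, hv₁, hv₁d⟩, ⟨⟨⟨hu₂, hu₂d⟩, -, hv₂d⟩, h₂⟩,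
          ⟨⟨hu₃, hu₃d⟩, -, hv₃d⟩, h₃⟩ := h
        obtain ⟨g, hg, ⟨rfl, rfl⟩, ⟨rfl, rfl⟩, rfl, rfl⟩ :=
          exists_monic_refinement_three hu₁ hv₁ hu₂ hu₃ h₂ h₃
        have hdeg : ∀ i j k l, (g i * g j * g k * g l).natDegree =
            (g i).natDegree + (g j).natDegree + (g k).natDegree + (g l).natDegree :=
          fun i j k l => by
            rw [(((hg i).mul (hg j)).mul (hg k)).natDegree_mul (hg l),
              ((hg i).mul (hg j)).natDegree_mul (hg k), (hg i).natDegree_mul (hg j)]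
        rw [hdeg] at hu₁d hv₁d hu₂d hv₂d hu₃d hv₃d
        refine ⟨g, ?_, rfl⟩
        simp only [coe_biUnion, Set.mem_iUnion, mem_coe, Fintype.mem_piFinset, mem_monicOfDegree]
        exact ⟨fun i => (g i).natDegree, mem_refinementDegrees.2
          ⟨⟨hu₁d, hv₁d⟩, ⟨hu₂d, hv₂d⟩, hu₃d, hv₃d⟩, fun i => ⟨hg i, rfl⟩⟩
    _ ≤ _ := by
        refine card_biUnion_le.trans_eq (sum_congr rfl fun d _ => ?_)
        simp only [Fintype.card_piFinset, card_monicOfDegree, prod_pow_eq_pow_sum]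

theorem varPhiNN_le {n : ℕ} (hn : 0 < n) : varPhiNN F n ≤ 832 * (n : ℝ) ^ 4 := by
  have hq := two_le_card_real F
  have hpow := pow_card_le_card_monicOfDegreeLE F n
  have hApos := (pow_pos (by linarith : (0 : ℝ) < Fintype.card F) n).trans_le hpow
  have hn1 : (1 : ℝ) ≤ n := by exact_mod_cast hn
  rw [varPhiNN, finsum_pairs_eq_sum, ncard_monic_natDegree_le]
  simp only [PhiN_eq_card]
  refine (sub_le_self _ (sq_nonneg _)).trans ?_
  rw [div_le_iff₀ (by positivity)]
  calc _ ≤ ∑ d ∈ refinementDegrees n, (Fintype.card F : ℝ) ^ (∑ i, d i) := by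
        exact_mod_cast sum_card_factorizations_sq_le F n
    _ ≤ 52 * ((n : ℝ) + 1) ^ 4 * (Fintype.card F : ℝ) ^ (2 * n) :=
        sum_pow_refinementDegrees_le hq n
    _ = 52 * ((n : ℝ) + 1) ^ 4 * ((Fintype.card F : ℝ) ^ n) ^ 2 := by rw [← pow_mul, mul_comm n]
    _ ≤ 52 * (2 * (n : ℝ)) ^ 4 * (#(monicOfDegreeLE F n) : ℝ) ^ 2 := by
        gcongr
        linarith
    _ = _ := by ring

end SecondMoment

/-- Theorem 5: `E[Φ_{n,n}] = (n+1)·q^{2n+1}·(q+1)/(q^{n+1}−1)² −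
(3·q^{n+1}−1)/((q^{n+1}−1)·(q−1))`; in particular there is an absolute `C > 0` with
`|E[Φ_{n,n}] − (n+1)| ≤ C·(n+1)/q`, and also `Var[Φ_{n,n}] ≤ C·n⁴`, for every finite field
`F` (of prime-power size `q = |F|`) and every positive integer `n`. -/
theorem expectation_variance_PhiNN :
    ∃ C : ℝ, 0 < C ∧
      ∀ (F : Type) [Field F] [Fintype F], ∀ n : ℕ, 0 < n →
        expPhiNN F n =
            ((n : ℝ) + 1) * (Fintype.card F : ℝ) ^ (2 * n + 1) *
                ((Fintype.card F : ℝ) + 1) / ((Fintype.card F : ℝ) ^ (n + 1) - 1) ^ 2 -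
              (3 * (Fintype.card F : ℝ) ^ (n + 1) - 1) /
                (((Fintype.card F : ℝ) ^ (n + 1) - 1) * ((Fintype.card F : ℝ) - 1)) ∧
        |expPhiNN F n - ((n : ℝ) + 1)| ≤ C * ((n : ℝ) + 1) / (Fintype.card F : ℝ) ∧
        varPhiNN F n ≤ C * (n : ℝ) ^ 4 := by
  refine ⟨832, by norm_num, fun F _ _ n hn => ⟨expPhiNN_closed_form F n, ?_, varPhiNN_le F hn⟩⟩
  refine (abs_expPhiNN_sub_le F n).trans ?_
  gcongr
  norm_num
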